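/- Existence of the thrust/attitude setpoint with imposed pitch angle (Appendix A, case 2). Let m, ρ, S > 0, c₀, c̄₀, c̿₀ ≥ 0, and α₀, θᵣ ∈ ℝ. Let k₀ ∈ ℝ³ be a unit vector and let a′, v_a ∈ ℝ³ satisfy v_a × a′ ≠ 0. Set jᵣ = (v_a × a′)/‖v_a × a′‖ and assume jᵣ × k₀ ≠ 0. Define η = (jᵣ × k₀)/‖jᵣ × k₀‖, η⊥ = (jᵣ × η)/‖jᵣ × η‖, iᵣ = cos θᵣ • η + sin θᵣ • η⊥, kᵣ = iᵣ × jᵣ, i₂ᵣ = cos α₀ • iᵣ − sin α₀ • kᵣ, and k₂ᵣ = sin α₀ • iᵣ + cos α₀ • kᵣ. Then there exist γ_T ∈ ℝ and Tₙ ∈ ℝ such that m • a′ = −(1/2)ρS‖v_a‖ (c₀⟪v_a, i₂ᵣ⟫ • i₂ᵣ + c̿₀⟪v_a, jᵣ⟫ • jᵣ + c̄₀⟪v_a, k₂ᵣ⟫ • k₂ᵣ) + Tₙ • (cos(γ_T + α₀) • i₂ᵣ + sin(γ_T + α₀) • k₂ᵣ). -/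

import Mathlib

open scoped RealInnerProductSpace
open Filter Real

abbrev E3 : Type := EuclideanSpace ℝ (Fin 3)

noncomputable def cross3 (x y : E3) : E3 :=
  (WithLp.equiv 2 (Fin 3 → ℝ)).symm
    ![x 1 * y 2 - x 2 * y 1, x 2 * y 0 - x 0 * y 2, x 0 * y 1 - x 1 * y 0]

def Orthonormal3 (i j k : E3) : Prop :=
  ‖i‖ = 1 ∧ ‖j‖ = 1 ∧ ‖k‖ = 1 ∧ ⟪i, j⟫ = 0 ∧ ⟪i, k⟫ = 0 ∧ ⟪j, k⟫ = 0


@[simp] lemma cross3_apply_zero (x y : E3) : cross3 x y 0 = x 1 * y 2 - x 2 * y 1 := rfl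

@[simp] lemma cross3_apply_one (x y : E3) : cross3 x y 1 = x 2 * y 0 - x 0 * y 2 := rfl

@[simp] lemma cross3_apply_two (x y : E3) : cross3 x y 2 = x 0 * y 1 - x 1 * y 0 := rfl

lemma E3.inner_eq (x y : E3) : ⟪x, y⟫ = x 0 * y 0 + x 1 * y 1 + x 2 * y 2 := by
  simp [PiLp.inner_apply, Fin.sum_univ_three, mul_comm]

lemma inner_left_cross3 (x y : E3) : ⟪x, cross3 x y⟫ = 0 := by
  simp only [E3.inner_eq, cross3_apply_zero, cross3_apply_one, cross3_apply_two]
  ring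

lemma inner_right_cross3 (x y : E3) : ⟪y, cross3 x y⟫ = 0 := by
  simp only [E3.inner_eq, cross3_apply_zero, cross3_apply_one, cross3_apply_two]
  ring

lemma norm_cross3_sq (x y : E3) :
    ‖cross3 x y‖ ^ 2 = ‖x‖ ^ 2 * ‖y‖ ^ 2 - ⟪x, y⟫ ^ 2 := by
  simp only [← real_inner_self_eq_norm_sq, E3.inner_eq, cross3_apply_zero, cross3_apply_one,
    cross3_apply_two]
  ring

lemma norm_cross3_eq_one {x y : E3} (hx : ‖x‖ = 1) (hy : ‖y‖ = 1) (hxy : ⟪x, y⟫ = 0) :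
    ‖cross3 x y‖ = 1 := by
  have h := norm_cross3_sq x y
  rw [hx, hy, hxy] at h
  exact (sq_eq_sq₀ (norm_nonneg _) zero_le_one).mp (by linarith)

/-- The squared triple product is the Gram determinant. -/
lemma inner_cross3_sq (w x y : E3) :
    ⟪w, cross3 x y⟫ ^ 2 = ‖w‖ ^ 2 * (‖x‖ ^ 2 * ‖y‖ ^ 2 - ⟪x, y⟫ ^ 2)
      - ⟪w, x⟫ * (⟪w, x⟫ * ‖y‖ ^ 2 - ⟪x, y⟫ * ⟪w, y⟫)
      + ⟪w, y⟫ * (⟪w, x⟫ * ⟪x, y⟫ - ‖x‖ ^ 2 * ⟪w, y⟫) := by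
  simp only [← real_inner_self_eq_norm_sq, E3.inner_eq, cross3_apply_zero, cross3_apply_one,
    cross3_apply_two]
  ring

/-- A vector orthogonal to `y` is expanded in the orthonormal frame `x, x × y` of the plane
orthogonal to `y`. -/
lemma eq_inner_smul_add_inner_cross3_smul {w x y : E3} (hx : ‖x‖ = 1) (hy : ‖y‖ = 1)
    (hxy : ⟪x, y⟫ = 0) (hwy : ⟪w, y⟫ = 0) :
    w = ⟪w, x⟫ • x + ⟪w, cross3 x y⟫ • cross3 x y := by
  have hgram := inner_cross3_sq w x y
  have hxc := inner_left_cross3 x y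
  have hc := norm_cross3_eq_one hx hy hxy
  simp only [hx, hy, hxy, hwy] at hgram
  rw [← sub_eq_zero, ← norm_eq_zero, ← sq_eq_zero_iff, norm_sub_sq_real, norm_add_sq_real]
  simp only [inner_add_right, inner_smul_left, inner_smul_right, norm_smul, mul_pow, hx, hc, hxc,
    norm_eq_abs, sq_abs]
  linear_combination -hgram

lemma exists_polar (p q : ℝ) : ∃ γ r : ℝ, p = r * cos γ ∧ q = r * sin γ :=
  ⟨Complex.arg ⟨p, q⟩, ‖(⟨p, q⟩ : ℂ)‖, (Complex.norm_mul_cos_arg ⟨p, q⟩).symm,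
    (Complex.norm_mul_sin_arg ⟨p, q⟩).symm⟩

/-- Rotating an orthonormal-plane frame by `-α` and advancing the angle by `α` gives the same
direction. -/
lemma cos_add_smul_add_sin_add_smul_rotate (i k : E3) (γ α : ℝ) :
    cos (γ + α) • (cos α • i - sin α • k) + sin (γ + α) • (sin α • i + cos α • k)
      = cos γ • i + sin γ • k := by
  have hc : cos γ = cos (γ + α) * cos α + sin (γ + α) * sin α := by
    rw [← cos_sub, add_sub_cancel_right]
  have hs : sin γ = sin (γ + α) * cos α - cos (γ + α) * sin α := by
    rw [← sin_sub, add_sub_cancel_right]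
  rw [hc, hs]
  module

/-- **Existence of the thrust/attitude setpoint with imposed pitch angle**
(Appendix A, case 2). -/
theorem thrust_attitude_setpoint_imposed_pitch
    (m ρ S : ℝ) (hm : 0 < m) (hρ : 0 < ρ) (hS : 0 < S)
    (c₀ cbar₀ cbb₀ : ℝ) (hc₀ : 0 ≤ c₀) (hcbar₀ : 0 ≤ cbar₀) (hcbb₀ : 0 ≤ cbb₀)
    (α₀ θr : ℝ) (k₀ : E3) (hk₀ : ‖k₀‖ = 1)
    (a' va : E3) (hva : cross3 va a' ≠ 0)
    (jr : E3) (hjr : jr = ‖cross3 va a'‖⁻¹ • cross3 va a')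
    (hjk : cross3 jr k₀ ≠ 0)
    (η ηp ir kr i₂r k₂r : E3)
    (hη : η = ‖cross3 jr k₀‖⁻¹ • cross3 jr k₀)
    (hηp : ηp = ‖cross3 jr η‖⁻¹ • cross3 jr η)
    (hir : ir = Real.cos θr • η + Real.sin θr • ηp)
    (hkr : kr = cross3 ir jr)
    (hi₂r : i₂r = Real.cos α₀ • ir - Real.sin α₀ • kr)
    (hk₂r : k₂r = Real.sin α₀ • ir + Real.cos α₀ • kr) :
    ∃ γT Tn : ℝ,
      m • a' = -((1/2) * ρ * S * ‖va‖) •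
          ((c₀ * ⟪va, i₂r⟫) • i₂r + (cbb₀ * ⟪va, jr⟫) • jr + (cbar₀ * ⟪va, k₂r⟫) • k₂r)
        + Tn • (Real.cos (γT + α₀) • i₂r + Real.sin (γT + α₀) • k₂r) := by
  have hjr1 : ‖jr‖ = 1 := hjr ▸ norm_smul_inv_norm (𝕜 := ℝ) hva
  have hη1 : ‖η‖ = 1 := hη ▸ norm_smul_inv_norm (𝕜 := ℝ) hjk
  have hjη : ⟪jr, η⟫ = 0 := by rw [hη, inner_smul_right, inner_left_cross3, mul_zero]
  have hηp' : ηp = cross3 jr η := by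
    rw [hηp, norm_cross3_eq_one hjr1 hη1 hjη, inv_one, one_smul]
  have hηpj : ⟪ηp, jr⟫ = 0 := by rw [hηp', real_inner_comm, inner_left_cross3]
  have hηj : ⟪η, jr⟫ = 0 := by rw [real_inner_comm, hjη]
  have hirj : ⟪ir, jr⟫ = 0 := by
    rw [hir, inner_add_left, inner_smul_left, inner_smul_left, hηj, hηpj, mul_zero, mul_zero,
      add_zero]
  have hkrj : ⟪kr, jr⟫ = 0 := by rw [hkr, real_inner_comm, inner_right_cross3]
  have hir1 : ‖ir‖ = 1 := by
    have hsq : ‖ir‖ ^ 2 = 1 := by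
      rw [hir, hηp', norm_add_sq_real]
      simp only [norm_smul, mul_pow, inner_smul_left, inner_smul_right, inner_right_cross3,
        norm_cross3_eq_one hjr1 hη1 hjη, hη1, norm_eq_abs, sq_abs]
      linear_combination cos_sq_add_sin_sq θr
    exact (sq_eq_sq₀ (norm_nonneg _) zero_le_one).mp (by rw [hsq, one_pow])
  have hvaj : ⟪va, jr⟫ = 0 := by rw [hjr, inner_smul_right, inner_left_cross3, mul_zero]
  have haj : ⟪a', jr⟫ = 0 := by rw [hjr, inner_smul_right, inner_right_cross3, mul_zero]
  set F : E3 := -((1/2) * ρ * S * ‖va‖) •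
    ((c₀ * ⟪va, i₂r⟫) • i₂r + (cbb₀ * ⟪va, jr⟫) • jr + (cbar₀ * ⟪va, k₂r⟫) • k₂r) with hF
  have hFj : ⟪F, jr⟫ = 0 := by
    have hi₂j : ⟪i₂r, jr⟫ = 0 := by
      rw [hi₂r, inner_sub_left, inner_smul_left, inner_smul_left, hirj, hkrj]; simp
    have hk₂j : ⟪k₂r, jr⟫ = 0 := by
      rw [hk₂r, inner_add_left, inner_smul_left, inner_smul_left, hirj, hkrj]; simp
    rw [hF, inner_smul_left, inner_add_left, inner_add_left, inner_smul_left, inner_smul_left,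
      inner_smul_left, hi₂j, hk₂j, hvaj]
    simp
  have hwj : ⟪m • a' - F, jr⟫ = 0 := by
    rw [inner_sub_left, inner_smul_left, haj, hFj, mul_zero, sub_zero]
  have hw := eq_inner_smul_add_inner_cross3_smul hir1 hjr1 hirj hwj
  rw [← hkr] at hw
  obtain ⟨γ, r, hp, hq⟩ := exists_polar ⟪m • a' - F, ir⟫ ⟪m • a' - F, kr⟫
  refine ⟨γ, r, ?_⟩
  rw [hi₂r, hk₂r, cos_add_smul_add_sin_add_smul_rotate, smul_add, smul_smul, smul_smul, ← hp, ← hq,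
    ← hw, add_sub_cancel]
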